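/- arXiv:cs/0605137 — 6 statements merged into one kernel-verified Lean document; each statement's English description precedes it below -/
import Mathlib

section
/- Let ξ0 < ξ1 be reals and let A : [ξ0, ξ1] → (M×M real symmetric positive semidefinite matrices) be measurable. Assume there is a constant C > 0 such that A(ξ) ≼ C·I_M for every ξ, and there is an integrable function g : [ξ0, ξ1] → ℝ such that every nonzero eigenvalue λ of A(ξ) satisfies λ ≥ exp(g(ξ)). Then the limit as ε → 0⁺ of (∫_{ξ0}^{ξ1} log det(A(ξ) + ε·I_M) dξ) / log ε equals Σ_{i=0}^{M} (M − i)·μ({ξ ∈ [ξ0, ξ1] : rank(A(ξ)) = i}), where μ is Lebesgue measure. -/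
open MeasureTheory

open Filter Topology in
lemma tendsto_log_add_div_log {x : ℝ} (hx : 0 ≤ x) :
    Tendsto (fun ε : ℝ => Real.log (x + ε) / Real.log ε) (𝓝[>] 0)
      (𝓝 (if x = 0 then 1 else 0)) := by
  split_ifs with h
  · subst h
    refine tendsto_const_nhds.congr' ?_
    filter_upwards [Ioo_mem_nhdsGT (zero_lt_one (α := ℝ))] with ε hε
    rw [zero_add, div_self (Real.log_neg hε.1 hε.2).ne]
  · have h1 : Tendsto (fun ε : ℝ => Real.log (x + ε)) (𝓝[>] 0) (𝓝 (Real.log x)) := by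
      have h2 : Tendsto (fun ε : ℝ => x + ε) (𝓝[>] 0) (𝓝 (x + 0)) :=
        ((continuous_const.add continuous_id).tendsto 0).mono_left nhdsWithin_le_nhds
      rw [add_zero] at h2
      exact h2.log h
    exact h1.div_atBot Real.tendsto_log_nhdsGT_zero

lemma abs_log_add_div_log_le {x ε C y : ℝ} (hx : 0 ≤ x) (hxC : x ≤ C)
    (hy : x ≠ 0 → Real.exp y ≤ x) (hε : 0 < ε) (hε' : ε < Real.exp (-1)) :
    |Real.log (x + ε) / Real.log ε| ≤ 1 + |y| + |Real.log (C + 1)| := by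
  have hlog : Real.log ε < -1 := (Real.log_lt_iff_lt_exp hε).2 hε'
  have hε1 : ε < 1 := hε'.trans (by simp)
  rcases hx.eq_or_lt with rfl | hpos
  · rw [zero_add, div_self (by linarith), abs_one]
    linarith [abs_nonneg y, abs_nonneg (Real.log (C + 1))]
  · have hlower : y ≤ Real.log (x + ε) :=
      (Real.le_log_iff_exp_le (by linarith)).2 (by linarith [hy hpos.ne'])
    have hupper : Real.log (x + ε) ≤ Real.log (C + 1) :=
      Real.log_le_log (by linarith) (by linarith)
    have habs : |Real.log (x + ε)| ≤ |y| + |Real.log (C + 1)| := by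
      rw [abs_le]
      constructor <;>
        linarith [neg_abs_le y, abs_nonneg y, le_abs_self (Real.log (C + 1)),
          abs_nonneg (Real.log (C + 1))]
    rw [abs_div]
    have hone : 1 ≤ |Real.log ε| := by rw [abs_of_neg (by linarith)]; linarith
    linarith [div_le_self (abs_nonneg (Real.log (x + ε))) hone]

namespace Matrix

variable {n : Type*} [Fintype n] [DecidableEq n] {A : Matrix n n ℝ}

lemma IsHermitian.det_add_smul_one (hA : A.IsHermitian) (ε : ℝ) :
    (A + ε • 1).det = ∏ i, (hA.eigenvalues i + ε) := by
  have h := Matrix.eval_charpoly A (-ε)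
  rw [hA.charpoly_eq, Polynomial.eval_prod] at h
  have h2 : A + ε • 1 = -(scalar n (-ε) - A) := by
    rw [scalar_apply, ← smul_one_eq_diagonal, neg_smul]
    abel
  rw [h2, det_neg, ← h, ← Finset.card_univ, ← Finset.prod_const, ← Finset.prod_mul_distrib]
  refine Finset.prod_congr rfl fun i _ => ?_
  simp [add_comm]

lemma IsHermitian.sum_ite_eigenvalues_eq_zero (hA : A.IsHermitian) :
    ∑ i, (if hA.eigenvalues i = 0 then (1 : ℝ) else 0) = Fintype.card n - A.rank := by
  rw [hA.rank_eq_card_non_zero_eigs, Fintype.card_subtype, Finset.sum_boole, eq_sub_iff_add_eq]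
  norm_cast
  exact Finset.card_filter_add_card_filter_not _

lemma IsHermitian.eigenvalues_le (hA : A.IsHermitian) {C : ℝ}
    (hC : (C • (1 : Matrix n n ℝ) - A).PosSemidef) (i : n) : hA.eigenvalues i ≤ C := by
  have hmem : C - hA.eigenvalues i ∈ spectrum ℝ (C • (1 : Matrix n n ℝ) - A) := by
    rw [← Algebra.algebraMap_eq_smul_one, ← spectrum.singleton_sub_eq]
    exact Set.sub_mem_sub rfl (hA.eigenvalues_mem_spectrum_real i)
  rw [hC.1.spectrum_real_eq_range_eigenvalues] at hmem
  obtain ⟨j, hj⟩ := hmem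
  linarith [hC.eigenvalues_nonneg j]

lemma PosSemidef.log_det_add_smul_one (hA : A.PosSemidef) {ε : ℝ} (hε : 0 < ε) :
    Real.log (A + ε • 1).det = ∑ i, Real.log (hA.1.eigenvalues i + ε) := by
  rw [hA.1.det_add_smul_one, Real.log_prod]
  intro i _
  linarith [hA.eigenvalues_nonneg i]

open Filter Topology in
lemma PosSemidef.tendsto_log_det_add_smul_one_div_log (hA : A.PosSemidef) :
    Tendsto (fun ε : ℝ => Real.log (A + ε • 1).det / Real.log ε) (𝓝[>] 0)
      (𝓝 (Fintype.card n - A.rank)) := by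
  rw [← hA.1.sum_ite_eigenvalues_eq_zero]
  refine (tendsto_finsetSum _ fun i _ =>
    tendsto_log_add_div_log (hA.eigenvalues_nonneg i)).congr' ?_
  filter_upwards [self_mem_nhdsWithin] with ε hε
  rw [hA.log_det_add_smul_one hε, Finset.sum_div]

lemma PosSemidef.abs_log_det_add_smul_one_div_log_le (hA : A.PosSemidef) {ε C y : ℝ}
    (hC : (C • (1 : Matrix n n ℝ) - A).PosSemidef)
    (hy : ∀ x ∈ spectrum ℝ A, x ≠ 0 → Real.exp y ≤ x) (hε : 0 < ε) (hε' : ε < Real.exp (-1)) :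
    |Real.log (A + ε • 1).det / Real.log ε| ≤
      Fintype.card n * (1 + |y| + |Real.log (C + 1)|) := by
  rw [hA.log_det_add_smul_one hε, Finset.sum_div, ← nsmul_eq_mul]
  refine (Finset.abs_sum_le_sum_abs _ _).trans (Finset.sum_le_card_nsmul _ _ _ fun i _ => ?_)
  exact abs_log_add_div_log_le (hA.eigenvalues_nonneg i) (hA.1.eigenvalues_le hC i)
    (hy _ (hA.1.eigenvalues_mem_spectrum_real i)) hε hε'

end Matrix

lemma integral_eq_sum_mul_measureReal_fiber {Ω : Type*} [MeasurableSpace Ω] {μ : Measure Ω}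
    [IsFiniteMeasure μ] {r : Ω → ℕ} {N : ℕ} (hr : ∀ ω, r ω < N) (f : ℕ → ℝ)
    (hmeas : ∀ i, NullMeasurableSet {ω | r ω = i} μ) :
    ∫ ω, f (r ω) ∂μ = ∑ i ∈ Finset.range N, f i * μ.real {ω | r ω = i} := by
  have hsum : ∀ ω, f (r ω) =
      ∑ i ∈ Finset.range N, Set.indicator {ω | r ω = i} (fun _ => f i) ω := by
    intro ω
    rw [Finset.sum_eq_single (r ω)]
    · simp
    · intro i _ hi
      simp [hi.symm]
    · intro h
      exact absurd (Finset.mem_range.2 (hr ω)) h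
  simp_rw [hsum]
  rw [integral_finsetSum _ fun i _ => (integrable_const (f i)).indicator₀ (hmeas i)]
  refine Finset.sum_congr rfl fun i _ => ?_
  rw [integral_indicator₀ (hmeas i), setIntegral_const, smul_eq_mul, mul_comm]

/-- Lemma 1 of the paper: for a measurable family `A ξ` of `M × M` real symmetric
positive semidefinite matrices on `[ξ0, ξ1]`, uniformly bounded above (in the Loewner
order) by `C • I` and whose nonzero eigenvalues are bounded below by `exp (g ξ)` for an
integrable `g`, the limit as `ε → 0⁺` of
`(∫_{ξ0}^{ξ1} log det (A ξ + ε • I) dξ) / log ε` equals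
`∑_{i=0}^{M} (M - i) · μ {ξ : rank (A ξ) = i}`. -/
theorem stmt1 (M : ℕ) (ξ0 ξ1 : ℝ) (hξ : ξ0 < ξ1)
    (A : ℝ → Matrix (Fin M) (Fin M) ℝ)
    (hmeas : ∀ i j, Measurable fun ξ => A ξ i j)
    (hpsd : ∀ ξ ∈ Set.Icc ξ0 ξ1, (A ξ).PosSemidef)
    (C : ℝ) (hC : 0 < C)
    (hbound : ∀ ξ ∈ Set.Icc ξ0 ξ1,
      (C • (1 : Matrix (Fin M) (Fin M) ℝ) - A ξ).PosSemidef)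
    (g : ℝ → ℝ) (hg : IntegrableOn g (Set.Icc ξ0 ξ1))
    (heig : ∀ ξ ∈ Set.Icc ξ0 ξ1, ∀ lam : ℝ, lam ∈ spectrum ℝ (A ξ) → lam ≠ 0 →
      Real.exp (g ξ) ≤ lam) :
    Filter.Tendsto (fun ε : ℝ =>
      (∫ ξ in Set.Icc ξ0 ξ1, Real.log (A ξ + ε • 1).det) / Real.log ε)
      (nhdsWithin 0 (Set.Ioi 0))
      (nhds (∑ i ∈ Finset.range (M + 1),
        ((M : ℝ) - (i : ℝ)) *
          (volume {ξ ∈ Set.Icc ξ0 ξ1 | (A ξ).rank = i}).toReal)) := by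
  simp_rw [← integral_div]
  set μ := volume.restrict (Set.Icc ξ0 ξ1) with hμ
  have hF : ∀ ε : ℝ, AEStronglyMeasurable
      (fun ξ => Real.log (A ξ + ε • 1).det / Real.log ε) μ := by
    intro ε
    have hdet : Measurable fun ξ => (A ξ + ε • 1).det := by
      simp only [Matrix.det_apply, Matrix.add_apply]
      fun_prop
    exact (hdet.log.div_const _).aestronglyMeasurable
  have hlim : ∀ᵐ ξ ∂μ, Filter.Tendsto
      (fun ε : ℝ => Real.log (A ξ + ε • 1).det / Real.log ε) (nhdsWithin 0 (Set.Ioi 0))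
      (nhds ((M : ℝ) - (A ξ).rank)) := by
    filter_upwards [ae_restrict_mem measurableSet_Icc] with ξ h
    simpa using (hpsd ξ h).tendsto_log_det_add_smul_one_div_log
  have hrank : AEStronglyMeasurable (fun ξ => (M : ℝ) - (A ξ).rank) μ :=
    aestronglyMeasurable_of_tendsto_ae _ hF hlim
  have hfiber : ∀ i, NullMeasurableSet {ξ | (A ξ).rank = i} μ := by
    intro i
    have h := hrank.aemeasurable.nullMeasurable (measurableSet_singleton ((M : ℝ) - i))
    have hset : {ξ | (A ξ).rank = i} =
        (fun ξ => (M : ℝ) - (A ξ).rank) ⁻¹' {(M : ℝ) - i} := by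
      ext ξ
      simp
    rwa [hset]
  have hvalue : ∫ ξ, ((M : ℝ) - (A ξ).rank) ∂μ = ∑ i ∈ Finset.range (M + 1),
      ((M : ℝ) - (i : ℝ)) * (volume {ξ ∈ Set.Icc ξ0 ξ1 | (A ξ).rank = i}).toReal := by
    rw [integral_eq_sum_mul_measureReal_fiber (r := fun ξ => (A ξ).rank) (N := M + 1)
      (fun ξ => Nat.lt_succ_of_le (by simpa using (A ξ).rank_le_width))
      (fun i => (M : ℝ) - i) hfiber]
    refine Finset.sum_congr rfl fun i _ => ?_
    rw [measureReal_def, hμ, Measure.restrict_apply' measurableSet_Icc, Set.inter_comm]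
    rfl
  rw [← hvalue]
  refine tendsto_integral_filter_of_dominated_convergence
    (fun ξ => (M : ℝ) * (1 + |g ξ| + |Real.log (C + 1)|))
    (Filter.Eventually.of_forall hF) ?_ ?_ hlim
  · filter_upwards [Ioo_mem_nhdsGT (Real.exp_pos (-1))] with ε hε
    filter_upwards [ae_restrict_mem measurableSet_Icc] with ξ h
    simpa [abs_div] using (hpsd ξ h).abs_log_det_add_smul_one_div_log_le (hbound ξ h) (heig ξ h)
      hε.1 hε.2
  · exact (((integrable_const 1).add hg.abs).add (integrable_const _)).const_mul _
end

section
/- Let c > 0 and let α ∈ [0, 2π). Let s : [−π, π] → ℝ be measurable with s(ω) ≥ 0 for all ω, ∫_{−π}^{π} s(ω) dω = 2π, and μ({ω : s(ω) = 0}) = α, where μ is Lebesgue measure. Then ∫_{−π}^{π} log(s(ω) + c) dω ≤ α·log c + (2π − α)·log(2π/(2π − α) + c), with equality if and only if s(ω) = 2π/(2π − α) for almost every ω in the set {ω : s(ω) > 0}. -/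
open MeasureTheory

theorem log_le_log_add_sub_div {x y : ℝ} (hx : 0 < x) (hy : 0 < y) :
    Real.log x ≤ Real.log y + (x - y) / y := by
  have h := Real.log_le_sub_one_of_pos (div_pos hx hy)
  rw [Real.log_div hx.ne' hy.ne'] at h
  rw [sub_div, div_self hy.ne']
  linarith

theorem log_eq_log_add_sub_div_iff {x y : ℝ} (hx : 0 < x) (hy : 0 < y) :
    Real.log x = Real.log y + (x - y) / y ↔ x = y := by
  refine ⟨fun h => ?_, fun h => by simp [h]⟩
  by_contra hne
  have h' := Real.log_lt_sub_one_of_pos (div_pos hx hy) (by rwa [Ne, div_eq_one_iff_eq hy.ne'])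
  rw [Real.log_div hx.ne' hy.ne'] at h'
  rw [sub_div, div_self hy.ne'] at h
  linarith

theorem integrable_log_add_const {X : Type*} [MeasurableSpace X] {μ : Measure X}
    [IsFiniteMeasure μ] {s : X → ℝ} {c : ℝ} (hc : 0 < c) (hs : Integrable s μ)
    (hnn : ∀ x, 0 ≤ s x) : Integrable (fun x => Real.log (s x + c)) μ := by
  refine ((hs.div_const c).add (integrable_const |Real.log c|)).mono'
    (Real.measurable_log.comp_aemeasurable
      (hs.aemeasurable.add_const c)).aestronglyMeasurable (.of_forall fun x => ?_)
  have hlow := Real.log_le_log hc (le_add_of_nonneg_left (hnn x))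
  have hupp := log_le_log_add_sub_div (add_pos_of_nonneg_of_pos (hnn x) hc) hc
  rw [add_sub_cancel_right] at hupp
  have hdiv : 0 ≤ s x / c := div_nonneg (hnn x) hc.le
  simp only [Pi.add_apply, Real.norm_eq_abs]
  exact abs_le.2 ⟨by linarith [neg_abs_le (Real.log c)], by linarith [le_abs_self (Real.log c)]⟩

/-- Jensen's inequality for `x ↦ log (x + c)`, with its equality case. -/
theorem integral_log_add_const_le_and_eq_iff {X : Type*} [MeasurableSpace X] {μ : Measure X}
    [IsFiniteMeasure μ] {s : X → ℝ} {c m : ℝ} (hc : 0 < c) (hm : 0 ≤ m) (hs : Integrable s μ)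
    (hnn : ∀ x, 0 ≤ s x) (hmean : ∫ x, s x ∂μ = μ.real Set.univ * m) :
    ∫ x, Real.log (s x + c) ∂μ ≤ μ.real Set.univ * Real.log (m + c) ∧
    (∫ x, Real.log (s x + c) ∂μ = μ.real Set.univ * Real.log (m + c) ↔ ∀ᵐ x ∂μ, s x = m) := by
  have hmc : 0 < m + c := by linarith
  have hpos (x : X) : 0 < s x + c := add_pos_of_nonneg_of_pos (hnn x) hc
  have hlog := integrable_log_add_const hc hs hnn
  have hdiff : Integrable (fun x => (s x + c - (m + c)) / (m + c)) μ :=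
    ((hs.add (integrable_const c)).sub (integrable_const (m + c))).div_const _
  have htan : Integrable (fun x => Real.log (m + c) + (s x + c - (m + c)) / (m + c)) μ :=
    (integrable_const _).add hdiff
  have htan_int : ∫ x, (Real.log (m + c) + (s x + c - (m + c)) / (m + c)) ∂μ =
      μ.real Set.univ * Real.log (m + c) := by
    rw [integral_add (integrable_const _) hdiff, integral_div]
    simp only [add_sub_add_right_eq_sub]
    rw [integral_sub hs (integrable_const _), hmean]
    simp
  have hle (x : X) := log_le_log_add_sub_div (hpos x) hmc
  rw [← htan_int]
  refine ⟨integral_mono hlog htan hle, ?_⟩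
  rw [integral_eq_iff_of_ae_le hlog htan (.of_forall hle)]
  refine Filter.eventually_congr (.of_forall fun x => ?_)
  rw [log_eq_log_add_sub_div_iff (hpos x) hmc, add_left_inj]

/-- Worst-case (flattest) spectrum: if `s ≥ 0` is measurable on `[-π, π]` with
`∫ s = 2π` and zero set of Lebesgue measure `α ∈ [0, 2π)`, then
`∫ log (s ω + c) dω ≤ α log c + (2π − α) log (2π/(2π − α) + c)`, with equality iff
`s ω = 2π/(2π − α)` for almost every `ω` in the set where `s ω > 0`. -/
theorem stmt5 (c α : ℝ) (hc : 0 < c) (hα : α ∈ Set.Ico 0 (2 * Real.pi))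
    (s : ℝ → ℝ) (hmeas : Measurable s)
    (hnn : ∀ ω, 0 ≤ s ω)
    (hint : ∫ ω in Set.Icc (-Real.pi) Real.pi, s ω = 2 * Real.pi)
    (hzero : volume {ω ∈ Set.Icc (-Real.pi) Real.pi | s ω = 0} = ENNReal.ofReal α) :
    (∫ ω in Set.Icc (-Real.pi) Real.pi, Real.log (s ω + c)) ≤
      α * Real.log c +
        (2 * Real.pi - α) * Real.log (2 * Real.pi / (2 * Real.pi - α) + c) ∧
    ((∫ ω in Set.Icc (-Real.pi) Real.pi, Real.log (s ω + c)) =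
        α * Real.log c +
          (2 * Real.pi - α) * Real.log (2 * Real.pi / (2 * Real.pi - α) + c) ↔
      ∀ᵐ ω ∂(volume.restrict {ω ∈ Set.Icc (-Real.pi) Real.pi | 0 < s ω}),
        s ω = 2 * Real.pi / (2 * Real.pi - α)) := by
  obtain ⟨hα0, hα1⟩ := hα
  set I := Set.Icc (-Real.pi) Real.pi with hI
  set Z := {ω ∈ I | s ω = 0} with hZ
  set P := {ω ∈ I | 0 < s ω} with hP
  have hβ : 0 < 2 * Real.pi - α := by linarith
  have hZm : MeasurableSet Z := measurableSet_Icc.inter (hmeas (measurableSet_singleton 0))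
  have hPm : MeasurableSet P := measurableSet_Icc.inter (hmeas measurableSet_Ioi)
  have hunion : Z ∪ P = I := by
    ext ω
    have := (hnn ω).eq_or_lt
    simp only [hZ, hP, Set.mem_union, Set.mem_ofPred_eq]
    grind
  have hdisj : Disjoint Z P :=
    Set.disjoint_left.2 fun ω h h' => h'.2.ne' h.2
  have hsI : IntegrableOn s I := by
    by_contra h
    rw [integral_undef h] at hint
    linarith [Real.pi_pos]
  have hZI : Z ⊆ I := fun ω h => h.1
  have hPI : P ⊆ I := fun ω h => h.1
  have hIfin : volume I ≠ ⊤ := measure_Icc_lt_top.ne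
  have hPfin : volume P ≠ ⊤ := measure_ne_top_of_subset hPI hIfin
  have : IsFiniteMeasure (volume.restrict I) := ⟨by simpa using hIfin.lt_top⟩
  have : IsFiniteMeasure (volume.restrict P) := ⟨by simpa using hPfin.lt_top⟩
  have hZreal : volume.real Z = α := by
    rw [measureReal_def, hzero, ENNReal.toReal_ofReal hα0]
  have hPreal : volume.real P = 2 * Real.pi - α := by
    have h := measureReal_union hdisj hPm (measure_ne_top_of_subset hZI hIfin) hPfin
    rw [hunion, hZreal, hI, Real.volume_real_Icc_of_le (by linarith [Real.pi_pos])] at h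
    linarith
  have split (f : ℝ → ℝ) (hf : IntegrableOn f I) :
      ∫ ω in I, f ω = (∫ ω in Z, f ω) + ∫ ω in P, f ω := by
    rw [← hunion, setIntegral_union hdisj hPm (hf.mono_set hZI) (hf.mono_set hPI)]
  have hsP : ∫ ω in P, s ω = 2 * Real.pi := by
    have h := split s hsI
    rw [setIntegral_congr_fun hZm (g := fun _ => 0) fun ω h => h.2] at h
    simpa [hint] using h.symm
  have hlog : ∫ ω in I, Real.log (s ω + c) =
      α * Real.log c + ∫ ω in P, Real.log (s ω + c) := by
    rw [split _ (integrable_log_add_const hc hsI hnn),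
      setIntegral_congr_fun hZm (g := fun _ => Real.log c) fun ω h => by simp [h.2]]
    simp [hZreal]
  have hmain := integral_log_add_const_le_and_eq_iff (μ := volume.restrict P) hc
    (m := 2 * Real.pi / (2 * Real.pi - α)) (by have := Real.pi_pos; positivity)
    (hsI.mono_set hPI) hnn (by
      rw [measureReal_restrict_apply_univ, hPreal, hsP]
      field_simp)
  rw [measureReal_restrict_apply_univ, hPreal] at hmain
  rw [hlog, add_le_add_iff_left, add_right_inj]
  exact hmain
end

section
/- Fix α ∈ [0, 2π) and r > 0. Define κ = (α + min(r,1)·(2π − α))/(2π), and define c(r) = α·log 4 if 0 < r < 1, c(r) = α·log 4 + (2π − α)·log 5 if r = 1, and c(r) = 2π·log 4 if r > 1. For real s > 1 let F(s) = α·log(4/s) + (2π − α − s^{−r})·log(s^{−r} + 4/s) + s^{−r}·log((2π·s^{2r} − 2π·s^{r} + α·s^{r} + 1)/s^{r} + 4/s). Then the limit as s → ∞ of F(s) + 2π·κ·log s equals c(r). -/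
open Filter Topology

/-- A sum of two negative powers, rescaled by its dominant power, tends to the sum of
the coefficients that carry the dominant power. -/
theorem tendsto_rescaled_rpow_add (r : ℝ) :
    Tendsto (fun s : ℝ => s ^ (min r 1 - r) + 4 * s ^ (min r 1 - 1)) atTop
      (𝓝 (if r < 1 then 1 else if r = 1 then 5 else 4)) := by
  have key : ∀ a : ℝ, a < 0 → Tendsto (fun s : ℝ => s ^ a) atTop (𝓝 0) := fun a ha => by
    simpa using tendsto_rpow_neg_atTop (neg_pos.2 ha)
  rcases lt_trichotomy r 1 with h | h | h
  · rw [if_pos h, min_eq_left h.le]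
    simpa using (key (r - 1) (by linarith)).const_mul 4 |>.const_add 1
  · subst h
    norm_num
  · rw [if_neg h.not_gt, if_neg h.ne', min_eq_right h.le]
    simpa using (key (1 - r) (by linarith)).add_const 4

theorem tendsto_rpow_neg_mul_log_atTop {r : ℝ} (hr : 0 < r) :
    Tendsto (fun s : ℝ => s ^ (-r) * Real.log s) atTop (𝓝 0) := by
  refine (isLittleO_log_rpow_atTop hr).tendsto_div_nhds_zero.congr' ?_
  filter_upwards [eventually_gt_atTop 0] with s hs
  rw [Real.rpow_neg hs.le, div_eq_mul_inv, mul_comm]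

theorem log_rpow_neg_add_four_div (r : ℝ) {s : ℝ} (hs : 0 < s) :
    Real.log (s ^ (-r) + 4 / s) =
      -(min r 1) * Real.log s + Real.log (s ^ (min r 1 - r) + 4 * s ^ (min r 1 - 1)) := by
  have hne : s ^ (min r 1 - r) + 4 * s ^ (min r 1 - 1) ≠ 0 := by positivity
  rw [← Real.log_rpow hs, ← Real.log_mul (by positivity) hne, mul_add, mul_left_comm,
    ← Real.rpow_add hs, ← Real.rpow_add hs, show -(min r 1) + (min r 1 - r) = -r by ring,
    show -(min r 1) + (min r 1 - 1) = -1 by ring, Real.rpow_neg_one, div_eq_mul_inv]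

theorem spike_eq_rpow_mul (α r : ℝ) {s : ℝ} (hs : 0 < s) :
    (2 * Real.pi * s ^ (2 * r) - 2 * Real.pi * s ^ r + α * s ^ r + 1) / s ^ r + 4 / s =
      s ^ r * (2 * Real.pi
        + s ^ (-r) * (α - 2 * Real.pi + s ^ (-r) + 4 * s⁻¹)) := by
  have hp : 0 < s ^ r := Real.rpow_pos_of_pos hs r
  rw [Real.rpow_neg hs.le, two_mul r, Real.rpow_add hs]
  field_simp
  ring


/-- Appendix E computation: fix `α ∈ [0, 2π)` and `r > 0`, set
`κ = (α + min r 1 · (2π − α)) / (2π)` and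
`c(r) = α log 4` if `r < 1`, `= α log 4 + (2π − α) log 5` if `r = 1`,
`= 2π log 4` if `r > 1`.  With
`F s = α log (4/s) + (2π − α − s^{-r}) log (s^{-r} + 4/s)
      + s^{-r} log ((2π s^{2r} − 2π s^{r} + α s^{r} + 1)/s^{r} + 4/s)`,
the limit as `s → ∞` of `F s + 2π κ log s` equals `c(r)`. -/
theorem stmt8 (α r : ℝ) (hα : α ∈ Set.Ico 0 (2 * Real.pi)) (hr : 0 < r) :
    Filter.Tendsto (fun s : ℝ =>
      (α * Real.log (4 / s)
        + (2 * Real.pi - α - s ^ (-r)) * Real.log (s ^ (-r) + 4 / s)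
        + s ^ (-r) * Real.log
            ((2 * Real.pi * s ^ (2 * r) - 2 * Real.pi * s ^ r + α * s ^ r + 1)
              / s ^ r + 4 / s))
      + 2 * Real.pi * ((α + min r 1 * (2 * Real.pi - α)) / (2 * Real.pi))
          * Real.log s)
      Filter.atTop
      (nhds (if r < 1 then α * Real.log 4
             else if r = 1 then α * Real.log 4 + (2 * Real.pi - α) * Real.log 5
             else 2 * Real.pi * Real.log 4)) := by
  have hpi := Real.pi_pos
  let h : ℝ → ℝ := fun s =>
    2 * Real.pi + s ^ (-r) * (α - 2 * Real.pi + s ^ (-r) + 4 * s⁻¹)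
  have ht : Tendsto (fun s : ℝ => s ^ (-r)) atTop (𝓝 0) := tendsto_rpow_neg_atTop hr
  have htL := tendsto_rpow_neg_mul_log_atTop hr
  have hlim_h : Tendsto h atTop (𝓝 (2 * Real.pi)) := by
    simpa using (ht.mul ((ht.const_add (α - 2 * Real.pi)).add
      (tendsto_inv_atTop_zero.const_mul 4))).const_add (2 * Real.pi)
  have hlog_g := (tendsto_rescaled_rpow_add r).log (by split_ifs <;> norm_num)
  have hlog_h := hlim_h.log (by positivity)
  have hmain := (((ht.const_sub (2 * Real.pi - α)).mul hlog_g).const_add (α * Real.log 4)).add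
    ((htL.const_mul (min r 1 + r)).add (ht.mul hlog_h))
  have hc : (if r < 1 then α * Real.log 4
             else if r = 1 then α * Real.log 4 + (2 * Real.pi - α) * Real.log 5
             else 2 * Real.pi * Real.log 4) =
      α * Real.log 4 + (2 * Real.pi - α - 0)
        * Real.log (if r < 1 then 1 else if r = 1 then 5 else 4)
        + ((min r 1 + r) * 0 + 0 * Real.log (2 * Real.pi)) := by
    split_ifs
    · simp
    · ring
    · ring
  rw [hc]
  refine hmain.congr' ?_
  filter_upwards [eventually_gt_atTop 0, hlim_h.eventually_ne (by positivity)] with s hs hhs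
  rw [spike_eq_rpow_mul α r hs, Real.log_mul (by positivity) hhs, Real.log_rpow hs,
    log_rpow_neg_add_four_div r hs, Real.log_div four_ne_zero hs.ne',
    mul_div_cancel₀ _ (by positivity)]
  ring
end

section
/- Fix η ∈ (1, 2). For real s > η define E(s) = (η/2)·[s/η + 1 − (s/η − 1)·√(1 + 4/(s − η))] + log( s/η − (s·(s − η)/(2η))·(√(1 + 4/(s − η)) − 1) ). Then E(s) converges to η − 1 − log η as s → ∞, and η − 1 − log η > 0. -/
/-- AWGN random-coding exponent at rate `log s − log η` for `η ∈ (1, 2)`: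
`E(s)` converges to `η − 1 − log η` as `s → ∞`, and `η − 1 − log η > 0`. -/
theorem stmt9 (η : ℝ) (hη : η ∈ Set.Ioo 1 2) :
    Filter.Tendsto (fun s : ℝ =>
      (η / 2) * (s / η + 1 - (s / η - 1) * Real.sqrt (1 + 4 / (s - η)))
      + Real.log (s / η
          - (s * (s - η) / (2 * η)) * (Real.sqrt (1 + 4 / (s - η)) - 1)))
      Filter.atTop (nhds (η - 1 - Real.log η)) ∧
    0 < η - 1 - Real.log η := by
  obtain ⟨h1, h2⟩ := hη
  have h0 : η ≠ 0 := by linarith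
  refine ⟨?_, by linarith [Real.log_lt_sub_one_of_pos (by linarith) h1.ne']⟩
  have hu : Filter.Tendsto (fun s : ℝ => s - η) Filter.atTop Filter.atTop :=
    Filter.tendsto_atTop_add_const_right _ (-η) Filter.tendsto_id
  have hdiv (c : ℝ) : Filter.Tendsto (fun s : ℝ => 1 + c / (s - η)) Filter.atTop (nhds 1) := by
    simpa using (hu.const_div_atTop c).const_add 1
  have hr : Filter.Tendsto (fun s : ℝ => Real.sqrt (1 + 4 / (s - η))) Filter.atTop (nhds 1) := by
    simpa using (hdiv 4).sqrt
  have hlim : Filter.Tendsto (fun s : ℝ => η - 2 / (Real.sqrt (1 + 4 / (s - η)) + 1)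
      + Real.log ((1 + η / (s - η)) * (4 / (η * (Real.sqrt (1 + 4 / (s - η)) + 1) ^ 2))))
      Filter.atTop (nhds (η - 2 / (1 + 1) + Real.log (1 * (4 / (η * (1 + 1) ^ 2))))) := by
    have hr1 := hr.add_const 1
    refine (tendsto_const_nhds.sub (tendsto_const_nhds.div hr1 (by norm_num))).add
      (((hdiv η).mul (tendsto_const_nhds.div ((hr1.pow 2).const_mul η) ?_)).log ?_)
    all_goals positivity
  have hval : η - 2 / (1 + 1) + Real.log (1 * (4 / (η * (1 + 1) ^ 2))) = η - 1 - Real.log η := by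
    have : 1 * (4 / (η * (1 + 1) ^ 2)) = η⁻¹ := by field_simp; norm_num
    rw [this, Real.log_inv]
    ring
  rw [hval] at hlim
  refine hlim.congr' ?_
  filter_upwards [Filter.eventually_gt_atTop η] with s hs
  have hs0 : 0 < s - η := sub_pos.2 hs
  have hsq : Real.sqrt (1 + 4 / (s - η)) ^ 2 = 1 + 4 / (s - η) := Real.sq_sqrt (by positivity)
  have hr0 : 0 ≤ Real.sqrt (1 + 4 / (s - η)) := Real.sqrt_nonneg _
  generalize Real.sqrt (1 + 4 / (s - η)) = r at *
  have hr1 : r + 1 ≠ 0 := by positivity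
  have hmul : (s - η) * (r ^ 2 - 1) = 4 := by rw [hsq]; field_simp; ring
  have hprod : (s - η) * (r - 1) = 4 / (r + 1) := by
    rw [eq_div_iff hr1]; linear_combination hmul
  congr 1
  · have : η / 2 * (s / η + 1 - (s / η - 1) * r) = η - (s - η) * (r - 1) / 2 := by
      field_simp; ring
    rw [this, hprod]
    ring
  · congr 1
    have hL : s / η - s * (s - η) / (2 * η) * (r - 1) = s / η * (1 - (s - η) * (r - 1) / 2) := by
      field_simp
    rw [hL, hprod]
    have hs1 := hs0.ne'
    field_simp
    linear_combination (-2 * s) * hmul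
end

section
/- For real s > 0 let I(s) = ∫_0^∞ (1/s + t/2)^{−1}·e^{−t} dt. Then I(s) ≤ 2·log(1 + s/2) + 2/e for every s > 0, and consequently liminf_{s→∞} [log log s − log I(s)] ≥ −log 2. -/
open MeasureTheory

theorem integrableOn_inv_add_mul_exp_neg {s : ℝ} (hs : 0 < s) :
    IntegrableOn (fun t : ℝ => (1 / s + t / 2)⁻¹ * Real.exp (-t)) (Set.Ioi 0) := by
  refine ((integrableOn_exp_neg_Ioi 0).const_mul s).mono' (by fun_prop) ?_
  filter_upwards [ae_restrict_mem measurableSet_Ioi] with t ht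
  have ht : 0 < t := ht
  rw [Real.norm_of_nonneg (by positivity)]
  gcongr
  rw [inv_le_comm₀ (by positivity) hs, one_div]
  linarith

theorem integral_inv_add_div_two {s : ℝ} (hs : 0 < s) :
    ∫ t in (0 : ℝ)..1, (1 / s + t / 2)⁻¹ = 2 * Real.log (1 + s / 2) := by
  rw [intervalIntegral.integral_comp_add_div (fun x : ℝ => x⁻¹) two_ne_zero,
    integral_inv_of_pos (by positivity) (by positivity), smul_eq_mul]
  congr 2
  field_simp
  ring

theorem setIntegral_inv_add_mul_exp_neg_le {s : ℝ} (hs : 0 < s) :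
    (∫ t in Set.Ioi (0 : ℝ), (1 / s + t / 2)⁻¹ * Real.exp (-t)) ≤
      2 * Real.log (1 + s / 2) + 2 / Real.exp 1 := by
  have hint := integrableOn_inv_add_mul_exp_neg hs
  have hnear := hint.mono_set (Set.Ioc_subset_Ioi_self (a := 1) (b := 0))
  have hfar := hint.mono_set (Set.Ioi_subset_Ioi (zero_le_one' ℝ))
  rw [← Set.Ioc_union_Ioi_eq_Ioi (zero_le_one' ℝ),
    setIntegral_union Set.Ioc_disjoint_Ioi_same measurableSet_Ioi hnear hfar]
  refine add_le_add ?_ ?_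
  · rw [← integral_inv_add_div_two hs, intervalIntegral.integral_of_le zero_le_one]
    refine setIntegral_mono_on hnear ?_ measurableSet_Ioc fun t ht => ?_
    · refine (ContinuousOn.integrableOn_Icc ?_).mono_set Set.Ioc_subset_Icc_self
      refine ContinuousOn.inv₀ (by fun_prop) fun t ht => ?_
      have := ht.1
      positivity
    · have := ht.1
      exact mul_le_of_le_one_right (by positivity) (Real.exp_le_one_iff.2 (by linarith))
  · have hexp : ∫ t in Set.Ioi (1 : ℝ), 2 * Real.exp (-t) = 2 / Real.exp 1 := by
      rw [integral_const_mul, integral_exp_neg_Ioi, Real.exp_neg, div_eq_mul_inv]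
    rw [← hexp]
    refine setIntegral_mono_on hfar ((integrableOn_exp_neg_Ioi 1).const_mul 2)
      measurableSet_Ioi fun t ht => ?_
    have ht : 1 < t := ht
    gcongr
    rw [inv_le_comm₀ (by positivity) two_pos]
    have : 0 < 1 / s := by positivity
    linarith

theorem neg_log_two_add_inv_log_le {s : ℝ} (hs : Real.exp 1 ≤ s) :
    -Real.log (2 + (Real.log s)⁻¹) ≤ Real.log (Real.log s)
      - Real.log (∫ t in Set.Ioi (0 : ℝ), (1 / s + t / 2)⁻¹ * Real.exp (-t)) := by
  have he : 2 < Real.exp 1 := by linarith [Real.exp_one_gt_d9]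
  have hs0 : 0 < s := by linarith
  have hlog : 1 ≤ Real.log s := (Real.le_log_iff_exp_le hs0).2 hs
  have hle : (∫ t in Set.Ioi (0 : ℝ), (1 / s + t / 2)⁻¹ * Real.exp (-t)) ≤
      2 * Real.log s + 1 := by
    refine (setIntegral_inv_add_mul_exp_neg_le hs0).trans (add_le_add ?_ ?_)
    · gcongr
      linarith
    · rw [div_le_one (by positivity)]
      exact he.le
  have hnonneg : 0 ≤ ∫ t in Set.Ioi (0 : ℝ), (1 / s + t / 2)⁻¹ * Real.exp (-t) := by
    refine setIntegral_nonneg measurableSet_Ioi fun t ht => ?_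
    have ht : 0 < t := ht
    positivity
  have hlogle : Real.log (∫ t in Set.Ioi (0 : ℝ), (1 / s + t / 2)⁻¹ * Real.exp (-t)) ≤
      Real.log (2 * Real.log s + 1) := by
    rcases hnonneg.eq_or_lt with h | h
    · rw [← h, Real.log_zero]
      exact Real.log_nonneg (by linarith)
    · exact Real.log_le_log h hle
  have hfactor : 2 * Real.log s + 1 = Real.log s * (2 + (Real.log s)⁻¹) := by
    field_simp
  rw [hfactor, Real.log_mul (by positivity) (by positivity)] at hlogle
  linarith

theorem tendsto_neg_log_two_add_inv_log :
    Filter.Tendsto (fun s : ℝ => -Real.log (2 + (Real.log s)⁻¹)) Filter.atTop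
      (nhds (-Real.log 2)) := by
  have h : Filter.Tendsto (fun s : ℝ => 2 + (Real.log s)⁻¹) Filter.atTop (nhds 2) := by
    simpa using Real.tendsto_log_atTop.inv_tendsto_atTop.const_add 2
  exact (h.log two_ne_zero).neg

/-- In the unbounded case the real `liminf` is `0`, which is why `b ≤ 0` suffices here. -/
theorem le_liminf_of_tendsto_of_eventually_le {α : Type*} {l : Filter α} {f g : α → ℝ} {b : ℝ}
    (hb : b ≤ 0) (hf : Filter.Tendsto f l (nhds b)) (hfg : ∀ᶠ x in l, f x ≤ g x) :
    b ≤ Filter.liminf g l := by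
  rw [Filter.liminf_eq]
  by_cases hbdd : BddAbove {a | ∀ᶠ x in l, a ≤ g x}
  · refine le_of_forall_lt fun a ha => ?_
    obtain ⟨c, hac, hcb⟩ := exists_between ha
    refine hac.trans_le (le_csSup hbdd ?_)
    filter_upwards [hf.eventually_const_lt hcb, hfg] with x hx hxg using hx.le.trans hxg
  · rwa [Real.sSup_of_not_bddAbove hbdd]

/-- With `I(s) = ∫_0^∞ (1/s + t/2)⁻¹ e^{-t} dt`, one has
`I(s) ≤ 2 log (1 + s/2) + 2/e` for every `s > 0`, and consequently
`liminf_{s → ∞} [log log s − log I(s)] ≥ −log 2`. -/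
theorem stmt10 :
    (∀ s : ℝ, 0 < s →
      (∫ t in Set.Ioi (0 : ℝ), (1 / s + t / 2)⁻¹ * Real.exp (-t)) ≤
        2 * Real.log (1 + s / 2) + 2 / Real.exp 1) ∧
    -Real.log 2 ≤ Filter.liminf (fun s : ℝ =>
      Real.log (Real.log s)
        - Real.log (∫ t in Set.Ioi (0 : ℝ), (1 / s + t / 2)⁻¹ * Real.exp (-t)))
      Filter.atTop := by
  refine ⟨fun s hs => setIntegral_inv_add_mul_exp_neg_le hs, ?_⟩
  refine le_liminf_of_tendsto_of_eventually_le
    (neg_nonpos.2 (Real.log_nonneg one_le_two)) tendsto_neg_log_two_add_inv_log ?_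
  filter_upwards [Filter.eventually_ge_atTop (Real.exp 1)] with s hs
  exact neg_log_two_add_inv_log_le hs
end

section
/- Let ρ ∈ [0, 1/2] and let s ≥ 0 be real. Then (1 + 3s + 2(1 − ρ²)·s²)² ≥ (1 + 2s)³. -/
/-- For `ρ ∈ [0, 1/2]` and `s ≥ 0`:
`(1 + 3s + 2(1 − ρ²)s²)² ≥ (1 + 2s)³`. -/
theorem stmt11 (ρ s : ℝ) (hρ : ρ ∈ Set.Icc 0 (1 / 2)) (hs : 0 ≤ s) :
    (1 + 2 * s) ^ 3 ≤ (1 + 3 * s + 2 * (1 - ρ ^ 2) * s ^ 2) ^ 2 := by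
  obtain ⟨h0, h1⟩ := hρ
  have hρ2 : ρ ^ 2 ≤ 1 / 4 := by nlinarith
  have hbase : 1 + 3 * s + 3 / 2 * s ^ 2 ≤ 1 + 3 * s + 2 * (1 - ρ ^ 2) * s ^ 2 := by
    nlinarith [sq_nonneg s]
  calc (1 + 2 * s) ^ 3 ≤ (1 + 2 * s) ^ 3 + (s ^ 3 + 9 / 4 * s ^ 4) :=
        le_add_of_nonneg_right (by positivity)
    _ = (1 + 3 * s + 3 / 2 * s ^ 2) ^ 2 := by ring
    _ ≤ (1 + 3 * s + 2 * (1 - ρ ^ 2) * s ^ 2) ^ 2 := by gcongr ?_ ^ 2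
end
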